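/- Derivative of a Chen line integral under a variation of the connection (the computation establishing Theorem 6.1: the Chen-bracket term in L_Z 𝒜(A,B) = ev₀*L_ZA + ∫_Chen L_ZB + ∫_Chen{L_ZA; B}). Let η̃, ζ : ℝ → 𝔤 be continuous, and let g : ℝ × ℝ → 𝔤 be C² (jointly in (κ,t)) with every value invertible, g κ 0 = 1 for all κ, g 0 t = 1 for all t, and ∂g/∂t (κ,t) = −κ • (η̃ t) * g κ t for all (κ,t). Then the function κ ↦ ∫_{t=0}^{1} (g κ t)⁻¹ * (ζ t) * (g κ t) dt is differentiable at κ = 0 with derivative ∫_{t=0}^{1} ⁅ ∫_{τ=0}^{t} η̃ τ dτ, ζ t ⁆ dt. -/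

import Mathlib

open MeasureTheory

noncomputable instance {n : ℕ} : NormedRing (Matrix (Fin n) (Fin n) ℝ) :=
  Matrix.linftyOpNormedRing

noncomputable instance {n : ℕ} : NormedAlgebra ℝ (Matrix (Fin n) (Fin n) ℝ) :=
  Matrix.linftyOpNormedAlgebra

noncomputable instance {n : ℕ} : NormedAddCommGroup (Matrix (Fin n) (Fin n) ℝ) :=
  inferInstance

noncomputable instance {n : ℕ} : NormedSpace ℝ (Matrix (Fin n) (Fin n) ℝ) :=
  inferInstance

/-- The Lie algebra `𝔤` of real `n × n` matrices. -/
abbrev 𝔤 (n : ℕ) : Type := Matrix (Fin n) (Fin n) ℝ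

/-- The inverse of a continuous family of invertible matrices is continuous. -/
lemma continuous_matrix_inv {X : Type*} [TopologicalSpace X] {n : ℕ} {f : X → 𝔤 n}
    (hf : Continuous f) (hu : ∀ x, IsUnit (f x)) : Continuous fun x => (f x)⁻¹ := by
  have h : ∀ x, (f x)⁻¹ = ((f x).det)⁻¹ • (f x).adjugate := fun x => by
    rw [Matrix.inv_def, Ring.inverse_eq_inv']
  simp_rw [h]
  exact (hf.matrix_det.inv₀ fun x =>
    ((Matrix.isUnit_iff_isUnit_det _).1 (hu x)).ne_zero).smul hf.matrix_adjugate

/-- If `F` is continuous at `0`, then `κ ↦ c + κ • F κ` has derivative `F 0` at `0`. -/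
lemma hasDerivAt_const_add_smul_zero {E : Type*} [NormedAddCommGroup E] [NormedSpace ℝ E]
    {F : ℝ → E} (hF : ContinuousAt F 0) (c : E) :
    HasDerivAt (fun κ => c + κ • F κ) (F 0) 0 := by
  rw [hasDerivAt_iff_tendsto_slope]
  refine (hF.tendsto.mono_left nhdsWithin_le_nhds).congr' ?_
  filter_upwards [self_mem_nhdsWithin] with κ hκ
  simp [slope_def_module, smul_smul, inv_mul_cancel₀ (show κ ≠ 0 from hκ)]

/-- Differentiation at `0` of the integral of the pencil `c t + κ • F κ t`. -/
lemma hasDerivAt_integral_add_smul_zero {E : Type*} [NormedAddCommGroup E] [NormedSpace ℝ E]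
    {c : ℝ → E} {F : ℝ → ℝ → E} (hc : Continuous c)
    (hF : Continuous fun p : ℝ × ℝ => F p.1 p.2) (a b : ℝ) :
    HasDerivAt (fun κ => ∫ t in a..b, (c t + κ • F κ t)) (∫ t in a..b, F 0 t) 0 := by
  have h : (fun κ => ∫ t in a..b, (c t + κ • F κ t)) =
      fun κ => (∫ t in a..b, c t) + κ • ∫ t in a..b, F κ t := by
    funext κ
    have hFκ : Continuous fun t => κ • F κ t :=
      (hF.comp (Continuous.prodMk_right κ)).const_smul κ
    rw [intervalIntegral.integral_add (hc.intervalIntegrable a b)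
      (hFκ.intervalIntegrable a b), intervalIntegral.integral_smul]
  rw [h]
  exact hasDerivAt_const_add_smul_zero
    (intervalIntegral.continuous_parametric_intervalIntegral_of_continuous'
      hF a b).continuousAt _

/-- Conjugation of `z` by an invertible `G = 1 + κ • P`, expanded around `z`. -/
lemma conj_one_add_smul {n : ℕ} {G P : 𝔤 n} (z : 𝔤 n) {κ : ℝ} (hu : IsUnit G)
    (hG : G = 1 + κ • P) : G⁻¹ * z * G = z + κ • (G⁻¹ * ⁅z, P⁆) := by
  have hinv : G⁻¹ * G = 1 :=
    Matrix.nonsing_inv_mul _ ((Matrix.isUnit_iff_isUnit_det _).1 hu)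
  have hcomm : z * G = G * z + κ • ⁅z, P⁆ := by
    rw [hG, Ring.lie_def, smul_sub]
    simp only [mul_add, add_mul, mul_one, one_mul, mul_smul_comm, smul_mul_assoc]
    abel
  rw [mul_assoc, hcomm, mul_add, ← mul_assoc, hinv, one_mul, mul_smul_comm]

/-- **Derivative of a Chen line integral under a variation of the connection**
(the computation establishing Theorem 6.1: the Chen-bracket term in
`L_Z 𝒜(A,B) = ev₀* L_Z A + ∫_Chen L_Z B + ∫_Chen {L_Z A; B}`).
If `g κ` solves `∂g/∂t = −κ • η̃(t) * g` with `g κ 0 = 1` and `g 0 ≡ 1`, then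
`κ ↦ ∫₀¹ (g κ t)⁻¹ * ζ t * g κ t dt` has derivative
`∫₀¹ ⁅∫₀ᵗ η̃ τ dτ, ζ t⁆ dt` at `κ = 0`. -/
theorem hasDerivAt_chen_line_integral {n : ℕ}
    (ηt ζ : ℝ → 𝔤 n) (hηt : Continuous ηt) (hζ : Continuous ζ)
    (g : ℝ → ℝ → 𝔤 n) (hg : ContDiff ℝ 2 (fun p : ℝ × ℝ => g p.1 p.2))
    (hgu : ∀ κ t, IsUnit (g κ t))
    (hg0 : ∀ κ, g κ 0 = 1) (hg0' : ∀ t, g 0 t = 1)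
    (hgd : ∀ κ t, deriv (fun t' => g κ t') t = -(κ • ηt t) * g κ t) :
    HasDerivAt (fun κ => ∫ t in (0:ℝ)..1, (g κ t)⁻¹ * ζ t * g κ t)
      (∫ t in (0:ℝ)..1, ⁅∫ τ in (0:ℝ)..t, ηt τ, ζ t⁆) 0 := by
  have hgc : Continuous fun p : ℝ × ℝ => g p.1 p.2 := hg.continuous
  have hint : Continuous fun p : ℝ × ℝ => ηt p.2 * g p.1 p.2 :=
    (hηt.comp continuous_snd).mul hgc
  set P : ℝ → ℝ → 𝔤 n := fun κ t => -∫ τ in (0:ℝ)..t, ηt τ * g κ τ with hP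
  have hPc : Continuous fun p : ℝ × ℝ => P p.1 p.2 := by
    refine (intervalIntegral.continuous_parametric_intervalIntegral_of_continuous
      (f := fun (p : ℝ × ℝ) τ => ηt τ * g p.1 τ) ?_ continuous_snd).neg
    exact hint.comp ((continuous_fst.comp continuous_fst).prodMk continuous_snd)
  have hgP : ∀ κ t, g κ t = 1 + κ • P κ t := fun κ t => by
    have hdiff : Differentiable ℝ fun t' => g κ t' :=
      (hg.differentiable two_ne_zero).comp ((differentiable_const κ).prodMk differentiable_id)
    have hder : ∀ s, HasDerivAt (fun t' => g κ t') (-(κ • (ηt s * g κ s))) s := fun s => by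
      refine (hdiff s).hasDerivAt.congr_deriv ((hgd κ s).trans ?_)
      rw [neg_mul, smul_mul_assoc]
    have hc : Continuous fun s => -(κ • (ηt s * g κ s)) :=
      ((hint.comp (continuous_const.prodMk continuous_id)).const_smul κ).neg
    have hftc := intervalIntegral.integral_eq_sub_of_hasDerivAt (fun s _ => hder s)
      (hc.intervalIntegrable 0 t)
    rw [intervalIntegral.integral_neg, intervalIntegral.integral_smul, hg0] at hftc
    rw [hP, smul_neg, hftc, add_sub_cancel]
  have hinv : Continuous fun p : ℝ × ℝ => (g p.1 p.2)⁻¹ :=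
    continuous_matrix_inv hgc fun p => hgu p.1 p.2
  have hFc : Continuous fun p : ℝ × ℝ => (g p.1 p.2)⁻¹ * ⁅ζ p.2, P p.1 p.2⁆ := by
    have hζ' : Continuous fun p : ℝ × ℝ => ζ p.2 := hζ.comp continuous_snd
    simp_rw [Ring.lie_def]
    exact hinv.mul ((hζ'.mul hPc).sub (hPc.mul hζ'))
  have hval : (∫ t in (0:ℝ)..1, ⁅∫ τ in (0:ℝ)..t, ηt τ, ζ t⁆) =
      ∫ t in (0:ℝ)..1, (g 0 t)⁻¹ * ⁅ζ t, P 0 t⁆ := by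
    simp only [hP, hg0', inv_one, one_mul, mul_one, Ring.lie_def, mul_neg, neg_mul,
      sub_neg_eq_add, neg_add_eq_sub]
  rw [hval, funext fun κ => intervalIntegral.integral_congr fun t _ =>
    conj_one_add_smul (ζ t) (hgu κ t) (hgP κ t)]
  exact hasDerivAt_integral_add_smul_zero hζ hFc 0 1
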